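/- arXiv:2207.13291 — 7 statements merged into one kernel-verified Lean document; each statement's English description precedes it below -/
import Mathlib

section
/- Let q be a finite indexed stream of type I → V whose reachable terminal state t satisfies ready(t) = false, and let f : V → R be a function into a commutative additive monoid R. Then the evaluation satisfies the recurrence ⟦q⟧_f = ⟦q⟧⁰_f + ⟦δ(q)⟧_f, where ⟦q⟧⁰_f denotes the function (fun y => if y = ι(q) then f(v(q)) else 0) when ready(q) = true and the zero function otherwise, and ⟦δ(q)⟧_f is the evaluation of the stream restarted at state δ(q). -/
/-- An indexed stream of type `I → V`: a state space `σ`, a current state `q`,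
an index function `ι`, a value function `v`, a ready flag, and a successor `δ`. -/
structure IStream (σ : Type*) (I : Type*) (V : Type*) where
  q : σ
  ι : σ → I
  v : σ → V
  ready : σ → Bool
  δ : σ → σ

namespace IStream

variable {σ σ₁ σ₂ : Type*} {I : Type*} {V : Type*}

/-- The set of states reachable from the current state. -/
def reachSet (s : IStream σ I V) : Set σ := {r | ∃ k : ℕ, r = s.δ^[k] s.q}

/-- A stream is finite if a terminal state is reachable from its current state. -/
def Finite (s : IStream σ I V) : Prop := ∃ t ∈ s.reachSet, s.δ t = t

/-- Finite, with the reachable terminal state not ready. -/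
def FiniteNR (s : IStream σ I V) : Prop :=
  ∃ t ∈ s.reachSet, s.δ t = t ∧ s.ready t = false

/-- Monotonic: the index is nondecreasing along every reachable transition. -/
def Monotonic [Preorder I] (s : IStream σ I V) : Prop :=
  ∀ r ∈ s.reachSet, s.ι r ≤ s.ι (s.δ r)

/-- Reduced: distinct reachable ready states (one reachable from the other)
have distinct indices. -/
def Reduced (s : IStream σ I V) : Prop :=
  ∀ r s', r ∈ s.reachSet → (∃ k : ℕ, s' = s.δ^[k] r) →
    s.ready r = true → s.ready s' = true → s.ι r = s.ι s' → r = s'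

/-- A simple stream: finite (with non-ready terminal state), monotonic, reduced. -/
def IsSimple [Preorder I] (s : IStream σ I V) : Prop :=
  s.FiniteNR ∧ s.Monotonic ∧ s.Reduced

/-- The stream restarted at the successor of its current state. -/
def step (s : IStream σ I V) : IStream σ I V := { s with q := s.δ s.q }

open Classical in
/-- Evaluation of a stream: the sum, over reachable states `r`, of the function
supported at `ι r` with value `f (v r)` when `ready r`, and `0` otherwise. -/
noncomputable def eval {R : Type*} [AddCommMonoid R] (s : IStream σ I V) (f : V → R) : I → R :=
  fun y => ∑ᶠ r ∈ s.reachSet,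
    if s.ready r = true then (if y = s.ι r then f (s.v r) else 0) else 0

/-- The product stream. -/
def mul [LinearOrder I] [Mul V] (a : IStream σ₁ I V) (b : IStream σ₂ I V) :
    IStream (σ₁ × σ₂) I V where
  q := (a.q, b.q)
  ι p := max (a.ι p.1) (b.ι p.2)
  v p := a.v p.1 * b.v p.2
  ready p := a.ready p.1 && b.ready p.2 && decide (a.ι p.1 = b.ι p.2)
  δ p := if a.ι p.1 < b.ι p.2 ∨ (a.ι p.1 = b.ι p.2 ∧ a.ready p.1 = false)
         then (a.δ p.1, p.2) else (p.1, b.δ p.2)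

/-- The sum stream. -/
def add [LinearOrder I] [Add V] [Zero V] (a : IStream σ₁ I V) (b : IStream σ₂ I V) :
    IStream (σ₁ × σ₂) I V where
  q := (a.q, b.q)
  ι p := min (a.ι p.1) (b.ι p.2)
  v p := (if a.ι p.1 ≤ b.ι p.2 then a.v p.1 else 0) +
         (if b.ι p.2 ≤ a.ι p.1 then b.v p.2 else 0)
  ready p := a.ready p.1 || b.ready p.2
  δ p := if a.ι p.1 < b.ι p.2 ∨ (a.ι p.1 = b.ι p.2 ∧ a.ready p.1 = false ∧ b.ready p.2 = true)
         then (a.δ p.1, p.2)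
         else if b.ι p.2 < a.ι p.1 ∨ (a.ι p.1 = b.ι p.2 ∧ b.ready p.2 = false ∧ a.ready p.1 = true)
         then (p.1, b.δ p.2)
         else (a.δ p.1, b.δ p.2)

end IStream

namespace IStream

variable {σ I V : Type*}

theorem reachSet_eq_insert_step (s : IStream σ I V) :
    s.reachSet = insert s.q s.step.reachSet := by
  ext r
  constructor
  · rintro ⟨k, rfl⟩
    cases k with
    | zero => exact Or.inl rfl
    | succ k => exact Or.inr ⟨k, rfl⟩
  · rintro (rfl | ⟨k, rfl⟩)
    · exact ⟨0, rfl⟩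
    · exact ⟨k + 1, rfl⟩

/-- Once a fixed point is reached, the orbit stays there. -/
theorem iterate_eq_of_le {δ : σ → σ} {q : σ} {n m : ℕ}
    (h : δ (δ^[n] q) = δ^[n] q) (hnm : n ≤ m) : δ^[m] q = δ^[n] q := by
  obtain ⟨j, rfl⟩ := Nat.exists_eq_add_of_le' hnm
  rw [Function.iterate_add_apply]
  exact Function.iterate_fixed h j

theorem Finite.finite_reachSet {s : IStream σ I V} (h : s.Finite) : s.reachSet.Finite := by
  obtain ⟨_, ⟨n, rfl⟩, ht⟩ := h
  refine ((Set.finite_Iic n).image fun k => s.δ^[k] s.q).subset ?_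
  rintro _ ⟨k, rfl⟩
  rcases le_total k n with hk | hk
  · exact ⟨k, hk, rfl⟩
  · exact ⟨n, Set.mem_Iic.2 le_rfl, (iterate_eq_of_le ht hk).symm⟩

/-- If the current state recurs, it is the terminal state, hence not ready. -/
theorem FiniteNR.ready_eq_false {s : IStream σ I V} (h : s.FiniteNR)
    (hq : s.q ∈ s.step.reachSet) : s.ready s.q = false := by
  obtain ⟨_, ⟨n, rfl⟩, ht, hr⟩ := h
  obtain ⟨k, hk⟩ := hq
  have hper : s.δ^[k + 1] s.q = s.q := hk.symm
  have hq' : s.δ^[(k + 1) * n] s.q = s.q := by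
    rw [Function.iterate_mul]
    exact Function.iterate_fixed hper n
  rwa [← iterate_eq_of_le ht (Nat.le_mul_of_pos_left n k.succ_pos), hq'] at hr

end IStream

open Classical in
/-- evaluation recurrence `⟦q⟧_f = ⟦q⟧⁰_f + ⟦δ(q)⟧_f` for a finite
stream whose reachable terminal state is not ready. -/
theorem eval_step_recurrence {σ I V R : Type*} [AddCommMonoid R]
    (s : IStream σ I V) (hfin : s.FiniteNR) (f : V → R) :
    s.eval f = fun y =>
      (if s.ready s.q = true then (if y = s.ι s.q then f (s.v s.q) else 0) else 0) +
        s.step.eval f y := by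
  funext y
  have hfinite : s.step.reachSet.Finite :=
    (IStream.Finite.finite_reachSet (hfin.imp fun _ h => ⟨h.1, h.2.1⟩)).subset
      (s.reachSet_eq_insert_step ▸ Set.subset_insert _ _)
  unfold IStream.eval
  rw [s.reachSet_eq_insert_step]
  by_cases hq : s.q ∈ s.step.reachSet
  · rw [Set.insert_eq_of_mem hq, hfin.ready_eq_false hq]
    simp only [Bool.false_eq_true, if_false, zero_add]
    rfl
  · rw [finsum_mem_insert _ hq hfinite]
    rfl
end

section
/- Let R be a commutative additive monoid with zero, I a linear order, k ≥ 1, x : Fin k → I strictly monotone, and w : Fin k → R. Define a stream q of type I → R with state space Fin (k+1), current state 0, ι(ℓ) = x(min(ℓ, k−1)), v(ℓ) = w(min(ℓ, k−1)), ready(ℓ) = (ℓ < k), and δ(ℓ) = min(ℓ+1, k). Then q is simple, and its evaluation with f = id is the function sending x(ℓ) to w(ℓ) for each ℓ : Fin k and every index outside the range of x to 0. -/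
namespace IStream

variable {σ I V R : Type*} [AddCommMonoid R]

theorem eval_eq_zero (s : IStream σ I V) (f : V → R) {y : I}
    (hy : ∀ r ∈ s.reachSet, s.ready r = true → y ≠ s.ι r) : s.eval f y = 0 :=
  finsum_mem_eq_zero_of_forall_eq_zero fun r hr => by
    split_ifs with h₁ h₂
    · exact absurd h₂ (hy r hr h₁)
    · rfl
    · rfl

/-- Of two reachable states, one is reachable from the other. -/
theorem reachSet_total (s : IStream σ I V) {r t : σ} (hr : r ∈ s.reachSet) (ht : t ∈ s.reachSet) :
    (∃ k : ℕ, t = s.δ^[k] r) ∨ ∃ k : ℕ, r = s.δ^[k] t := by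
  obtain ⟨m, rfl⟩ := hr
  obtain ⟨n, rfl⟩ := ht
  rcases le_total m n with h | h
  · exact .inl ⟨n - m, by rw [← Function.iterate_add_apply, Nat.sub_add_cancel h]⟩
  · exact .inr ⟨m - n, by rw [← Function.iterate_add_apply, Nat.sub_add_cancel h]⟩

/-- A reduced stream evaluates, at the index of a reachable ready state, to the value there. -/
theorem Reduced.eval_index {s : IStream σ I V} (hs : s.Reduced) (f : V → R) {r : σ}
    (hr : r ∈ s.reachSet) (hready : s.ready r = true) : s.eval f (s.ι r) = f (s.v r) := by
  unfold eval
  rw [finsum_eq_single _ r]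
  · simp [hr, hready]
  · intro t hne
    classical
    rw [finsum_eq_if]
    split_ifs with ht h₁ h₂
    · rcases s.reachSet_total hr ht with h | h
      · exact absurd (hs r t hr h hready h₁ h₂).symm hne
      · exact absurd (hs t r ht h h₁ hready h₂.symm) hne
    all_goals rfl

end IStream

/-- the stream of a sparse vector with `k ≥ 1` entries at strictly
increasing indices `x` with values `w` is simple, and its evaluation (with
`f = id`) sends `x ℓ` to `w ℓ` and every other index to `0`. -/
theorem sparse_vector_stream {I R : Type*} [LinearOrder I] [AddCommMonoid R]
    (k : ℕ) (hk : 1 ≤ k) (x : Fin k → I) (hx : StrictMono x) (w : Fin k → R) :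
    let q : IStream (Fin (k + 1)) I R :=
      { q := 0
        ι := fun ℓ => x ⟨min ℓ.val (k - 1), by omega⟩
        v := fun ℓ => w ⟨min ℓ.val (k - 1), by omega⟩
        ready := fun ℓ => decide (ℓ.val < k)
        δ := fun ℓ => ⟨min (ℓ.val + 1) k, by omega⟩ }
    q.IsSimple ∧ (∀ ℓ : Fin k, q.eval id (x ℓ) = w ℓ) ∧
      (∀ y : I, y ∉ Set.range x → q.eval id y = 0) := by
  intro q
  have hiter (n : ℕ) (hn : n ≤ k) : q.δ^[n] q.q = ⟨n, by omega⟩ := by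
    induction n with
    | zero => rfl
    | succ n ih =>
      rw [Function.iterate_succ_apply', ih (by omega)]
      exact Fin.ext (min_eq_left hn)
  have hreach (r : Fin (k + 1)) : r ∈ q.reachSet := ⟨r, (hiter r (by omega)).symm⟩
  have hready (r : Fin (k + 1)) : q.ready r = true ↔ r.val < k := decide_eq_true_iff
  have hred : q.Reduced := by
    intro r t _ _ hr ht h
    rw [hready] at hr ht
    have := congrArg Fin.val (hx.injective h)
    dsimp only at this
    exact Fin.ext (by omega)
  refine ⟨⟨⟨Fin.last k, hreach _, ?_, ?_⟩, ?_, hred⟩, ?_, ?_⟩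
  · exact Fin.ext (min_eq_right (Nat.le_succ k))
  · exact decide_eq_false (lt_irrefl k)
  · intro r _
    refine hx.monotone (Fin.mk_le_mk.mpr ?_)
    dsimp only [q]
    omega
  · intro ℓ
    have hmin : (⟨min ℓ.val (k - 1), by omega⟩ : Fin k) = ℓ := Fin.ext (by dsimp only; omega)
    have h := hred.eval_index id (hreach ℓ.castSucc) ((hready _).mpr ℓ.isLt)
    simpa only [q, Fin.val_castSucc, hmin, id] using h
  · intro y hy
    exact q.eval_eq_zero id fun r _ _ h => hy ⟨_, h.symm⟩
end

section
/- Let a and b be finite indexed streams of type I → V, where V carries a multiplication. Then the number of states of the product stream a·b reachable from its initial state (q_a, q_b) is at most size⁰(a) + size⁰(b), where size⁰ denotes the number of reachable states of a stream. -/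
namespace IStream

/-- The reachable states of a finite stream are enumerated without repetition by the iterates
up to the first terminal one. -/
theorem Finite.exists_card_reachSet_eq {σ I V : Type*} {s : IStream σ I V} (hs : s.Finite) :
    ∃ N : ℕ, s.δ (s.δ^[N] s.q) = s.δ^[N] s.q ∧ Nat.card s.reachSet = N + 1 := by
  classical
  have hex : ∃ k : ℕ, s.δ (s.δ^[k] s.q) = s.δ^[k] s.q := by
    obtain ⟨t, ⟨k, rfl⟩, ht⟩ := hs
    exact ⟨k, ht⟩
  obtain ⟨N, hN, hmin⟩ : ∃ N : ℕ, s.δ (s.δ^[N] s.q) = s.δ^[N] s.q ∧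
      ∀ m < N, s.δ (s.δ^[m] s.q) ≠ s.δ^[m] s.q :=
    ⟨Nat.find hex, Nat.find_spec hex, fun _ => Nat.find_min hex⟩
  refine ⟨N, hN, ?_⟩
  have hne : ∀ i j, i < j → j ≤ N → s.δ^[i] s.q ≠ s.δ^[j] s.q := by
    intro i j hij hj h
    apply hmin ((N - j) + i) (by omega)
    rw [Function.iterate_add_apply, h, ← Function.iterate_add_apply, Nat.sub_add_cancel hj, hN]
  have hreach : s.reachSet = ((Finset.range (N + 1)).image fun k => s.δ^[k] s.q : Finset σ) := by
    ext r
    simp only [reachSet, Set.mem_ofPred_eq, Finset.coe_image, Set.mem_image, Finset.mem_coe,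
      Finset.mem_range]
    constructor
    · rintro ⟨k, rfl⟩
      rcases Nat.lt_or_ge k (N + 1) with hk | hk
      · exact ⟨k, hk, rfl⟩
      · refine ⟨N, N.lt_succ_self, ?_⟩
        rw [← Nat.sub_add_cancel (show N ≤ k by omega), Function.iterate_add_apply,
          Function.iterate_fixed hN]
    · rintro ⟨k, -, rfl⟩
      exact ⟨k, rfl⟩
  rw [hreach, Nat.card_coe_set_eq, Set.ncard_coe_finset, Finset.card_image_of_injOn,
    Finset.card_range]
  intro i hi j hj h
  simp only [Finset.coe_range, Set.mem_Iio] at hi hj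
  rcases lt_trichotomy i j with hij | hij | hij
  · exact absurd h (hne i j hij (by omega))
  · exact hij
  · exact absurd h.symm (hne j i hij (by omega))

theorem mul_δ_eq_or {σ₁ σ₂ I V : Type*} [LinearOrder I] [Mul V]
    (a : IStream σ₁ I V) (b : IStream σ₂ I V) (p : σ₁ × σ₂) :
    (a.mul b).δ p = (a.δ p.1, p.2) ∨ (a.mul b).δ p = (p.1, b.δ p.2) :=
  ite_eq_or_eq _ _ _

/-- If the iterates `m` of `a` and `n` of `b` are terminal, then every reachable state of the
product is reached after at most `m + n` steps. -/
theorem exists_iterate_mul_eq {σ₁ σ₂ I V : Type*} [LinearOrder I] [Mul V]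
    (a : IStream σ₁ I V) (b : IStream σ₂ I V) {m n : ℕ}
    (hm : a.δ (a.δ^[m] a.q) = a.δ^[m] a.q) (hn : b.δ (b.δ^[n] b.q) = b.δ^[n] b.q) (k : ℕ) :
    ∃ i ≤ m, ∃ j ≤ n, (a.mul b).δ^[k] (a.mul b).q = (a.δ^[i] a.q, b.δ^[j] b.q) ∧
      (a.mul b).δ^[k] (a.mul b).q = (a.mul b).δ^[i + j] (a.mul b).q := by
  induction k with
  | zero => exact ⟨0, m.zero_le, 0, n.zero_le, rfl, rfl⟩
  | succ k ih =>
    obtain ⟨i, hi, j, hj, hstate, hiter⟩ := ih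
    have hsucc : (a.mul b).δ^[k + 1] (a.mul b).q = (a.mul b).δ^[i + j + 1] (a.mul b).q := by
      rw [Function.iterate_succ_apply', hiter, ← Function.iterate_succ_apply' (a.mul b).δ]
    have hstep := Function.iterate_succ_apply' (a.mul b).δ k (a.mul b).q
    rw [hstate] at hstep
    rcases mul_δ_eq_or a b (a.δ^[i] a.q, b.δ^[j] b.q) with h | h <;> rw [h] at hstep
    · rcases hi.lt_or_eq with hlt | rfl
      · refine ⟨i + 1, hlt, j, hj, ?_, ?_⟩
        · rw [hstep, Function.iterate_succ_apply']
        · rw [hsucc, Nat.add_right_comm]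
      · rw [hm, ← hstate] at hstep
        exact ⟨i, le_rfl, j, hj, hstep.trans hstate, hstep.trans hiter⟩
    · rcases hj.lt_or_eq with hlt | rfl
      · refine ⟨i, hi, j + 1, hlt, ?_, hsucc⟩
        rw [hstep, Function.iterate_succ_apply']
      · rw [hn, ← hstate] at hstep
        exact ⟨i, hi, j, le_rfl, hstep.trans hstate, hstep.trans hiter⟩

end IStream

/-- the number of reachable states of a product stream is at most
the sum of the numbers of reachable states of its factors. -/
theorem mul_size_le {σ₁ σ₂ I V : Type*} [LinearOrder I] [Mul V]
    (a : IStream σ₁ I V) (b : IStream σ₂ I V) (ha : a.Finite) (hb : b.Finite) :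
    Nat.card (a.mul b).reachSet ≤ Nat.card a.reachSet + Nat.card b.reachSet := by
  classical
  obtain ⟨m, hm, hcard_a⟩ := ha.exists_card_reachSet_eq
  obtain ⟨n, hn, hcard_b⟩ := hb.exists_card_reachSet_eq
  have hsub : (a.mul b).reachSet ⊆
      ((Finset.range (m + n + 1)).image fun k => (a.mul b).δ^[k] (a.mul b).q :
        Finset (σ₁ × σ₂)) := by
    rintro _ ⟨k, rfl⟩
    obtain ⟨i, hi, j, hj, -, hiter⟩ := IStream.exists_iterate_mul_eq a b hm hn k
    exact Finset.mem_image.2 ⟨i + j, Finset.mem_range.2 (by omega), hiter.symm⟩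
  have hle := Set.ncard_le_ncard hsub (Finset.finite_toSet _)
  rw [Set.ncard_coe_finset] at hle
  have himage := hle.trans Finset.card_image_le
  rw [Finset.card_range] at himage
  rw [hcard_a, hcard_b, Nat.card_coe_set_eq]
  omega
end

section
/- Let q be a finite indexed stream of type I → A, let h : A → B be any function, let M and N be commutative additive monoids, let g_A : A → M and g_B : B → N be value maps, and let f' : M → N be an additive monoid homomorphism satisfying g_B ∘ h = f' ∘ g_A. Let map h q denote the stream obtained from q by replacing its value function v with h ∘ v (same states, index, ready, successor). Then ⟦map h q⟧_{g_B} = f' ∘ ⟦q⟧_{g_A}. -/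
/-- The stream obtained by post-composing the value function with `h`. -/
def IStream.map {σ I A B : Type*} (h : A → B) (s : IStream σ I A) : IStream σ I B :=
  { q := s.q, ι := s.ι, v := h ∘ s.v, ready := s.ready, δ := s.δ }

/-- A finite stream has only finitely many reachable states. -/
theorem IStream.Finite.finite_reachSet_s6 {σ I V : Type*} {s : IStream σ I V} (hs : s.Finite) :
    s.reachSet.Finite := by
  obtain ⟨t, ⟨n, rfl⟩, ht⟩ := hs
  refine ((Set.finite_Iic n).image fun k => s.δ^[k] s.q).subset ?_
  rintro _ ⟨k, rfl⟩
  rcases le_total k n with hk | hk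
  · exact ⟨k, hk, rfl⟩
  · refine ⟨n, Set.self_mem_Iic, ?_⟩
    obtain ⟨m, rfl⟩ := Nat.exists_eq_add_of_le' hk
    simp only [Function.iterate_add_apply, Function.iterate_fixed ht]

/-- evaluating a mapped stream agrees with post-composing the
evaluation with a compatible additive monoid homomorphism. -/
theorem map_eval {σ I A B M N : Type*} [AddCommMonoid M] [AddCommMonoid N]
    (q : IStream σ I A) (hq : q.Finite) (h : A → B)
    (gA : A → M) (gB : B → N) (f' : M →+ N) (hcomm : gB ∘ h = ⇑f' ∘ gA) :
    (q.map h).eval gB = ⇑f' ∘ q.eval gA := by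
  funext y
  have hv (a : A) : gB (h a) = f' (gA a) := congrFun hcomm a
  simp only [Function.comp_apply, IStream.eval]
  rw [f'.map_finsum_mem _ hq.finite_reachSet_s6]
  simp only [apply_ite f', map_zero, ← hv]
  rfl
end

section
/- Let I be a finite linear order with exactly k elements, given by an order isomorphism e : Fin k ≃o I, and let v₀ : V. Then the constant (replication) stream ↑v₀ of type I → V is simple. -/
/-- The constant (replication) stream `↑v₀` over a finite linear order `I` with
exactly `k ≥ 1` elements given by an order isomorphism `e : Fin k ≃o I`. -/
def constStream {I V : Type*} [LinearOrder I] {k : ℕ} (hk : 1 ≤ k)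
    (e : Fin k ≃o I) (v₀ : V) : IStream (Fin (k + 1)) I V where
  q := 0
  ι r := e ⟨min r.val (k - 1), by omega⟩
  v _ := v₀
  ready r := decide (r.val < k)
  δ r := ⟨min (r.val + 1) k, by omega⟩

/-- After `n` steps the constant stream is in state `min n k`. -/
theorem constStream_iterate_δ_val {I V : Type*} [LinearOrder I] {k : ℕ} (hk : 1 ≤ k)
    (e : Fin k ≃o I) (v₀ : V) (n : ℕ) :
    ((constStream hk e v₀).δ^[n] (constStream hk e v₀).q).val = min n k := by
  induction n with
  | zero => simp [constStream]
  | succ n ih =>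
    rw [Function.iterate_succ_apply']
    change min (_ + 1) k = _
    rw [ih]
    omega

/-- the constant (replication) stream is simple. -/
theorem constStream_isSimple {I V : Type*} [LinearOrder I] {k : ℕ} (hk : 1 ≤ k)
    (e : Fin k ≃o I) (v₀ : V) : (constStream hk e v₀).IsSimple := by
  refine ⟨⟨Fin.last k, ⟨k, ?_⟩, ?_, ?_⟩, ?_, ?_⟩
  · exact Fin.ext (by simp [constStream_iterate_δ_val])
  · exact Fin.ext (by simp [constStream])
  · simp [constStream]
  · intro r _
    refine e.monotone ?_
    change min r.val (k - 1) ≤ min (min (r.val + 1) k) (k - 1)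
    omega
  · intro r s _ _ hr hs h
    have hr' : r.val < k := of_decide_eq_true hr
    have hs' : s.val < k := of_decide_eq_true hs
    have h' : min r.val (k - 1) = min s.val (k - 1) := congrArg Fin.val (e.injective h)
    exact Fin.ext (by omega)
end

section
/- If a and b are simple indexed streams of type I → V, where V carries a multiplication, then the product stream a·b is simple. -/
namespace IStream

theorem mul_iterate {σ₁ σ₂ I V : Type*} [LinearOrder I] [Mul V]
    (a : IStream σ₁ I V) (b : IStream σ₂ I V) (k : ℕ) (p : σ₁ × σ₂) :
    ∃ m n : ℕ, (a.mul b).δ^[k] p = (a.δ^[m] p.1, b.δ^[n] p.2) := by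
  induction k generalizing p with
  | zero => exact ⟨0, 0, rfl⟩
  | succ k ih =>
    obtain ⟨m, n, h⟩ := ih ((a.mul b).δ p)
    rw [Function.iterate_succ_apply, h]
    by_cases hc : a.ι p.1 < b.ι p.2 ∨ (a.ι p.1 = b.ι p.2 ∧ a.ready p.1 = false)
    · exact ⟨m + 1, n, by simp [mul, hc]⟩
    · exact ⟨m, n + 1, by simp only [mul, if_neg hc, Function.iterate_succ_apply]⟩

theorem mul_reachSet {σ₁ σ₂ I V : Type*} [LinearOrder I] [Mul V]
    {a : IStream σ₁ I V} {b : IStream σ₂ I V} {p : σ₁ × σ₂} (hp : p ∈ (a.mul b).reachSet) :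
    p.1 ∈ a.reachSet ∧ p.2 ∈ b.reachSet := by
  obtain ⟨k, rfl⟩ := hp
  obtain ⟨m, n, h⟩ := mul_iterate a b k (a.mul b).q
  rw [h]
  exact ⟨⟨m, rfl⟩, ⟨n, rfl⟩⟩

theorem exists_mul_iterate_terminal {σ₁ σ₂ I V : Type*} [LinearOrder I] [Mul V]
    {a : IStream σ₁ I V} {b : IStream σ₂ I V} {s : σ₁} {t : σ₂}
    (hs : a.δ s = s) (hs' : a.ready s = false) (ht : b.δ t = t) (ht' : b.ready t = false)
    (m n : ℕ) (x : σ₁) (y : σ₂) (hx : s = a.δ^[m] x) (hy : t = b.δ^[n] y) :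
    ∃ k : ℕ, (a.mul b).δ ((a.mul b).δ^[k] (x, y)) = (a.mul b).δ^[k] (x, y) ∧
      (a.mul b).ready ((a.mul b).δ^[k] (x, y)) = false := by
  by_cases hc : a.ι x < b.ι y ∨ (a.ι x = b.ι y ∧ a.ready x = false)
  · have hstep : (a.mul b).δ (x, y) = (a.δ x, y) := if_pos hc
    cases m with
    | zero =>
      obtain rfl : s = x := hx
      exact ⟨0, by simp [hstep, hs], by simp [mul, hs']⟩
    | succ m =>
      obtain ⟨k, hk⟩ := exists_mul_iterate_terminal hs hs' ht ht' m n (a.δ x) y hx hy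
      exact ⟨k + 1, by simpa only [Function.iterate_succ_apply, hstep] using hk⟩
  · have hstep : (a.mul b).δ (x, y) = (x, b.δ y) := if_neg hc
    cases n with
    | zero =>
      obtain rfl : t = y := hy
      exact ⟨0, by simp [hstep, ht], by simp [mul, ht']⟩
    | succ n =>
      obtain ⟨k, hk⟩ := exists_mul_iterate_terminal hs hs' ht ht' m n x (b.δ y) hx hy
      exact ⟨k + 1, by simpa only [Function.iterate_succ_apply, hstep] using hk⟩
termination_by m + n

theorem FiniteNR.mul {σ₁ σ₂ I V : Type*} [LinearOrder I] [Mul V]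
    {a : IStream σ₁ I V} {b : IStream σ₂ I V} (ha : a.FiniteNR) (hb : b.FiniteNR) :
    (a.mul b).FiniteNR := by
  obtain ⟨s, ⟨m, hm⟩, hs, hs'⟩ := ha
  obtain ⟨t, ⟨n, hn⟩, ht, ht'⟩ := hb
  obtain ⟨k, hk⟩ := exists_mul_iterate_terminal hs hs' ht ht' m n a.q b.q hm hn
  exact ⟨_, ⟨k, rfl⟩, hk⟩

theorem Monotonic.mul {σ₁ σ₂ I V : Type*} [LinearOrder I] [Mul V]
    {a : IStream σ₁ I V} {b : IStream σ₂ I V} (ha : a.Monotonic) (hb : b.Monotonic) :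
    (a.mul b).Monotonic := by
  intro p hp
  obtain ⟨h₁, h₂⟩ := mul_reachSet hp
  by_cases hc : a.ι p.1 < b.ι p.2 ∨ (a.ι p.1 = b.ι p.2 ∧ a.ready p.1 = false)
  · rw [show (a.mul b).δ p = (a.δ p.1, p.2) from if_pos hc]
    exact max_le_max_right _ (ha _ h₁)
  · rw [show (a.mul b).δ p = (p.1, b.δ p.2) from if_neg hc]
    exact max_le_max_left _ (hb _ h₂)

theorem Reduced.mul {σ₁ σ₂ I V : Type*} [LinearOrder I] [Mul V]
    {a : IStream σ₁ I V} {b : IStream σ₂ I V} (ha : a.Reduced) (hb : b.Reduced) :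
    (a.mul b).Reduced := by
  rintro r s hr ⟨k, hk⟩ hrr hsr hι
  obtain ⟨h₁, h₂⟩ := mul_reachSet hr
  obtain ⟨m, n, h⟩ := mul_iterate a b k r
  rw [h] at hk
  simp only [IStream.mul, Bool.and_eq_true, decide_eq_true_eq] at hrr hsr hι
  obtain ⟨⟨hra, hrb⟩, hre⟩ := hrr
  obtain ⟨⟨hsa, hsb⟩, hse⟩ := hsr
  rw [hre, hse, max_self, max_self] at hι
  exact Prod.ext
    (ha _ _ h₁ ⟨m, congrArg Prod.fst hk⟩ hra hsa (by rw [hre, hse, hι]))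
    (hb _ _ h₂ ⟨n, congrArg Prod.snd hk⟩ hrb hsb hι)

end IStream

/-- the product of simple streams is simple. -/
theorem mul_isSimple {σ₁ σ₂ I V : Type*} [LinearOrder I] [Mul V]
    (a : IStream σ₁ I V) (b : IStream σ₂ I V)
    (ha : a.IsSimple) (hb : b.IsSimple) : (a.mul b).IsSimple := by
  exact ⟨ha.1.mul hb.1, ha.2.1.mul hb.2.1, ha.2.2.mul hb.2.2⟩
end

section
/- Let q be a simple indexed stream of type I → V, where V is a commutative additive monoid, let R be a commutative additive monoid, and let f : V → R be an additive monoid homomorphism such that f(v(r)) = 0 for every reachable state r with ready(r) = false. Then f applied to the stream aggregate equals the total of the evaluation: f(Σq) = ∑ᶠ x : I, ⟦q⟧_f(x), where Σq is the sum of v(r) over all states r reachable from q, and the right-hand side is the (finitely supported) sum of ⟦q⟧_f over all indices x : I. -/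
namespace IStream

theorem Finite.reachSet_finite {σ I V : Type*} {s : IStream σ I V} (h : s.Finite) :
    s.reachSet.Finite := by
  obtain ⟨t, ⟨n, rfl⟩, ht⟩ := h
  refine ((Set.finite_Iic n).image fun k => s.δ^[k] s.q).subset ?_
  rintro _ ⟨k, rfl⟩
  rcases le_total k n with hk | hk
  · exact ⟨k, hk, rfl⟩
  · obtain ⟨m, rfl⟩ := Nat.exists_eq_add_of_le hk
    refine ⟨n, Set.self_mem_Iic, ?_⟩
    rw [add_comm, Function.iterate_add_apply, Function.iterate_fixed ht]

theorem FiniteNR.finite {σ I V : Type*} {s : IStream σ I V} (h : s.FiniteNR) : s.Finite :=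
  let ⟨t, ht, hδ, _⟩ := h
  ⟨t, ht, hδ⟩

/-- The total of the evaluation is the sum of the values at the ready reachable states. -/
theorem finsum_eval {σ I V R : Type*} [AddCommMonoid R] {s : IStream σ I V}
    (h : s.reachSet.Finite) (f : V → R) :
    ∑ᶠ x, s.eval f x = ∑ r ∈ h.toFinset, if s.ready r = true then f (s.v r) else 0 := by
  classical
  simp only [eval, finsum_mem_eq_finite_toFinset_sum _ h]
  rw [finsum_sum_comm]
  · refine Finset.sum_congr rfl fun r _ => ?_
    rw [finsum_eq_single _ (s.ι r) fun x hx => by simp [hx]]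
    simp
  · refine fun r _ => (Set.finite_singleton (s.ι r)).subset fun x hx => ?_
    by_contra hne
    exact hx (by simp [show x ≠ s.ι r from hne])

end IStream

/-- `f` applied to the stream aggregate `Σq` (the sum of the
values over all reachable states) equals the total of the evaluation over all
indices. -/
theorem sigma_eval {σ I V R : Type*} [LinearOrder I] [AddCommMonoid V] [AddCommMonoid R]
    (q : IStream σ I V) (hq : q.IsSimple) (f : V →+ R)
    (h0 : ∀ r ∈ q.reachSet, q.ready r = false → f (q.v r) = 0) :
    f (∑ᶠ r ∈ q.reachSet, q.v r) = ∑ᶠ x : I, q.eval ⇑f x := by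
  have hfin := hq.1.finite.reachSet_finite
  rw [IStream.finsum_eval hfin, finsum_mem_eq_finite_toFinset_sum _ hfin, map_sum]
  refine Finset.sum_congr rfl fun r hr => ?_
  cases hready : q.ready r
  · simpa using h0 r (hfin.mem_toFinset.1 hr) hready
  · simp
end
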